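/- arXiv:2203.03019 — 8 statements merged into one kernel-verified Lean document; each statement's English description precedes it below -/
import Mathlib

section
/- Let r ≥ 2 and let n = kr+1 for some integer k ≥ 1. Let F(n,r) be the set system on ground set [n] consisting of all 2-element subsets of [n] that are not r-stable. Then the r-colorability defect of F(n,r) equals 1, i.e. cd_r(F(n,r)) = 1. -/
open Classical

/-- A subset `σ ⊆ [n]` is `r`-stable if `r ≤ |i - j| ≤ n - r` for all distinct `i, j ∈ σ`. -/
def rStable (n r : ℕ) (σ : Finset ℕ) : Prop :=
  ∀ i ∈ σ, ∀ j ∈ σ, i < j → r ≤ j - i ∧ j - i ≤ n - r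

/-- A subset `σ ⊆ [n]` is almost `r`-stable if `|i - j| ≥ r` for all distinct `i, j ∈ σ`. -/
def almostRStable (r : ℕ) (σ : Finset ℕ) : Prop :=
  ∀ i ∈ σ, ∀ j ∈ σ, i < j → r ≤ j - i

/-- `F(n,r)`: all 2-element subsets of `[n] = {1, ..., n}` that are not `r`-stable. -/
def Fnr (n r : ℕ) : Set (Finset ℕ) :=
  {σ | σ ⊆ Finset.Icc 1 n ∧ σ.card = 2 ∧ ¬ rStable n r σ}

/-- The hypergraph with vertex set `V` and edge set `E` admits a proper `m`-coloring
(colors `{1, ..., m}`, no monochromatic edge). -/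
def Colorable (V : Finset ℕ) (E : Set (Finset ℕ)) (m : ℕ) : Prop :=
  ∃ c : ℕ → ℕ, (∀ v ∈ V, c v ∈ Finset.Icc 1 m) ∧
    ∀ e ∈ E, ∃ i ∈ e, ∃ j ∈ e, c i ≠ c j

/-- The `r`-colorability defect of the hypergraph `(V, E)`: the minimum number of vertices
to delete so that the induced hypergraph on the remaining vertices is `r`-colorable. -/
noncomputable def cd (r : ℕ) (V : Finset ℕ) (E : Set (Finset ℕ)) : ℕ :=
  sInf {b | ∃ B : Finset ℕ, B ⊆ V ∧ B.card = b ∧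
    Colorable (V \ B) {e ∈ E | e ⊆ V \ B} r}

/-- `KG^r(F)` admits a proper `m`-coloring: a map `c` on the members of `F` with colors in
`{1, ..., m}` such that no `r`-element set of pairwise disjoint members of `F` is
monochromatic. -/
def KGColorable (r : ℕ) (F : Set (Finset ℕ)) (m : ℕ) : Prop :=
  ∃ c : Finset ℕ → ℕ, (∀ A ∈ F, c A ∈ Finset.Icc 1 m) ∧
    ∀ E : Finset (Finset ℕ), E.card = r → ↑E ⊆ F →
      (∀ A ∈ E, ∀ B ∈ E, A ≠ B → Disjoint A B) →
      ∃ A ∈ E, ∃ B ∈ E, c A ≠ c B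

/-- The chromatic number of the Kneser hypergraph `KG^r(F)`. -/
noncomputable def chiKG (r : ℕ) (F : Set (Finset ℕ)) : ℕ :=
  sInf {m | KGColorable r F m}

/-- The `r`-stable members of a set system `F` on `[n]`. -/
def rStabPart (n r : ℕ) (F : Set (Finset ℕ)) : Set (Finset ℕ) :=
  {σ ∈ F | rStable n r σ}

/-- The almost `r`-stable members of a set system `F`. -/
def almostStabPart (r : ℕ) (F : Set (Finset ℕ)) : Set (Finset ℕ) :=
  {σ ∈ F | almostRStable r σ}

/-- The extra family `G = {{1+ir, 1+(i+1)r} : i = 0, ..., 2r-3} ∪ {{(2r-2)r+1, 1}}`. -/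
def Gfam (r : ℕ) : Set (Finset ℕ) :=
  {σ | ∃ i, i ≤ 2 * r - 3 ∧ σ = ({1 + i * r, 1 + (i + 1) * r} : Finset ℕ)} ∪
    {({(2 * r - 2) * r + 1, 1} : Finset ℕ)}

/-- A pair `i < j` in `[n]` with `j - i < r` or `n - r < j - i` is an edge of `F(n,r)`. -/
theorem pair_mem_Fnr {n r i j : ℕ} (hi : 1 ≤ i) (hij : i < j) (hj : j ≤ n)
    (h : j - i < r ∨ n - r < j - i) : ({i, j} : Finset ℕ) ∈ Fnr n r := by
  refine ⟨?_, Finset.card_pair hij.ne, fun hs => ?_⟩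
  · intro x hx
    simp only [Finset.mem_insert, Finset.mem_singleton] at hx
    simp only [Finset.mem_Icc]
    omega
  · have := hs i (by simp) j (by simp) hij
    omega

/-- Every edge of `F(n,r)` is a pair `i < j` with `j - i < r` or `n - r < j - i`. -/
theorem exists_pair_of_mem_Fnr {n r : ℕ} {e : Finset ℕ} (he : e ∈ Fnr n r) :
    ∃ i ∈ e, ∃ j ∈ e, i < j ∧ (j - i < r ∨ n - r < j - i) := by
  have h := he.2.2
  unfold rStable at h
  push Not at h
  obtain ⟨i, hi, j, hj, hij, h⟩ := h
  refine ⟨i, hi, j, hj, hij, ?_⟩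
  by_contra! hc
  exact absurd (h hc.1) (by omega)

/-- Deleting the vertex `kr + 1` from `F(kr + 1, r)` leaves an `r`-colorable hypergraph. -/
theorem colorable_Fnr_sdiff_singleton {r k : ℕ} (hr : 2 ≤ r) (hk : 1 ≤ k) :
    Colorable (Finset.Icc 1 (k * r + 1) \ {k * r + 1})
      {e ∈ Fnr (k * r + 1) r | e ⊆ Finset.Icc 1 (k * r + 1) \ {k * r + 1}} r := by
  refine ⟨fun v => v % r + 1, fun v _ => ?_, ?_⟩
  · have := Nat.mod_lt v (show 0 < r by omega)
    simp only [Finset.mem_Icc]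
    omega
  · rintro e ⟨he, hsub⟩
    obtain ⟨i, hi, j, hj, hij, h⟩ := exists_pair_of_mem_Fnr he
    refine ⟨i, hi, j, hj, fun hc => ?_⟩
    have hi' := hsub hi
    have hj' := hsub hj
    simp only [Finset.mem_sdiff, Finset.mem_Icc, Finset.mem_singleton] at hi' hj'
    obtain ⟨q, hq⟩ : r ∣ j - i :=
      (Nat.modEq_iff_dvd' hij.le).1 (Nat.add_right_cancel hc)
    obtain ⟨l, rfl⟩ := Nat.exists_eq_add_of_le' hk
    rw [Nat.add_mul, Nat.one_mul] at hi' hj' h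
    rcases Nat.lt_or_ge l q with hlq | hlq
    · have := Nat.mul_le_mul_left r hlq
      rw [Nat.mul_succ, Nat.mul_comm r l] at this
      omega
    · have h₁ := Nat.mul_le_mul_left r hlq
      rw [Nat.mul_comm r l] at h₁
      have h₂ : 0 < q := Nat.pos_of_ne_zero fun h0 => by
        rw [h0, Nat.mul_zero] at hq
        omega
      have h₃ := Nat.mul_le_mul_left r h₂
      omega

/-- A map to `r` colors separating any two points of `[n]` at distance less than `r` is
`r`-periodic on `[n]`. -/
theorem color_add_eq {n r : ℕ} {c : ℕ → ℕ}
    (hc : ∀ v ∈ Finset.Icc 1 n, c v ∈ Finset.Icc 1 r)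
    (hne : ∀ i j, 1 ≤ i → i < j → j ≤ n → j - i < r → c i ≠ c j)
    {i : ℕ} (hi : 1 ≤ i) (hin : i + r ≤ n) : c (i + r) = c i := by
  obtain ⟨x, hx, y, hy, hxy, hcxy⟩ :=
    Finset.exists_ne_map_eq_of_card_lt_of_maps_to (s := Finset.Icc i (i + r))
      (t := Finset.Icc 1 r) (f := c) (by simp only [Nat.card_Icc]; omega)
      (fun v hv => hc v (by
        rw [Finset.mem_coe, Finset.mem_Icc] at hv
        rw [Finset.mem_Icc]
        omega))
  wlog hlt : x < y generalizing x y
  · exact this y hy x hx hxy.symm hcxy.symm (by omega)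
  rw [Finset.mem_Icc] at hx hy
  by_cases hd : y - x < r
  · exact absurd hcxy (hne x y (by omega) hlt (by omega) hd)
  · obtain rfl : x = i := by omega
    obtain rfl : y = x + r := by omega
    exact hcxy.symm

/-- The hypergraph `F(kr + 1, r)` is not `r`-colorable. -/
theorem not_colorable_Fnr {r k : ℕ} (hr : 2 ≤ r) (hk : 1 ≤ k) :
    ¬ Colorable (Finset.Icc 1 (k * r + 1)) (Fnr (k * r + 1) r) r := by
  rintro ⟨c, hc, hE⟩
  have hne : ∀ i j, 1 ≤ i → i < j → j ≤ k * r + 1 →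
      (j - i < r ∨ k * r + 1 - r < j - i) → c i ≠ c j := by
    intro i j hi hij hj h heq
    obtain ⟨x, hx, y, hy, hxy⟩ := hE _ (pair_mem_Fnr hi hij hj h)
    simp only [Finset.mem_insert, Finset.mem_singleton] at hx hy
    rcases hx with rfl | rfl <;> rcases hy with rfl | rfl <;> simp_all
  have hper : ∀ m ≤ k, c (m * r + 1) = c 1 := by
    intro m
    induction m with
    | zero => simp
    | succ m ih =>
      intro hm
      have hle := Nat.mul_le_mul_right r hm
      rw [← ih (by omega), Nat.add_mul, Nat.one_mul, Nat.add_right_comm]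
      rw [Nat.add_mul, Nat.one_mul] at hle
      exact color_add_eq hc (fun i j h₁ h₂ h₃ h₄ => hne i j h₁ h₂ h₃ (Or.inl h₄))
        (by omega) (by omega)
  have hrk := Nat.mul_le_mul_right r hk
  exact hne 1 (k * r + 1) le_rfl (by omega) le_rfl (by omega) (hper k le_rfl).symm

/-- For `r ≥ 2` and `n = kr + 1` with `k ≥ 1`, `cd_r(F(n,r)) = 1`. -/
theorem stmt_0 (r k n : ℕ) (hr : 2 ≤ r) (hk : 1 ≤ k) (hn : n = k * r + 1) :
    cd r (Finset.Icc 1 n) (Fnr n r) = 1 := by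
  subst hn
  have hone : 1 ∈ {b | ∃ B : Finset ℕ, B ⊆ Finset.Icc 1 (k * r + 1) ∧ B.card = b ∧
      Colorable (Finset.Icc 1 (k * r + 1) \ B)
        {e ∈ Fnr (k * r + 1) r | e ⊆ Finset.Icc 1 (k * r + 1) \ B} r} :=
    ⟨{k * r + 1}, by simp, by simp, colorable_Fnr_sdiff_singleton hr hk⟩
  refine le_antisymm (Nat.sInf_le hone) (le_csInf ⟨1, hone⟩ ?_)
  rintro b ⟨B, -, rfl, c, hc, hE⟩
  rw [Nat.one_le_iff_ne_zero, Ne, Finset.card_eq_zero]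
  rintro rfl
  rw [Finset.sdiff_empty] at hc hE
  exact not_colorable_Fnr hr hk ⟨c, hc, fun e he => hE e ⟨he, he.1⟩⟩
end

section
/- Let r ≥ 2 and let n = kr+1 for some integer k ≥ 1. Let F(n,r) be the set system on ground set [n] consisting of all 2-element subsets of [n] that are not r-stable. Then cd_r(F(n,r)) ≤ 1: after removing the vertex n, the set system induced on [n−1] is r-colorable; explicitly, the coloring assigning to each vertex v ∈ [n−1] the color i ∈ {1,...,r} with v ≡ i (mod r) is a proper r-coloring of the induced hypergraph. -/
open Classical

/-- If two vertices of `[kr]` are distinct and have the same residue mod `r`, their distance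
lies between `r` and `(k - 1)r`. -/
theorem dist_bounds_of_sub_one_mod_eq {r k i j : ℕ} (hi : 1 ≤ i) (hij : i < j)
    (hj : j ≤ k * r) (h : (i - 1) % r = (j - 1) % r) :
    r ≤ j - i ∧ j - i ≤ k * r + 1 - r := by
  have hdvd : r ∣ j - i := by
    have hd := (Nat.modEq_iff_dvd' (by omega : i - 1 ≤ j - 1)).1 h
    rwa [show j - 1 - (i - 1) = j - i by omega] at hd
  have hle : r ≤ j - i := Nat.le_of_dvd (by omega) hdvd
  obtain ⟨q, hq⟩ := hdvd
  refine ⟨hle, ?_⟩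
  have hqk : q < k := by
    by_contra! hkq
    have := Nat.mul_le_mul_right r hkq
    rw [mul_comm] at hq
    omega
  have := Nat.mul_le_mul_right r (Nat.succ_le_of_lt hqk)
  rw [Nat.succ_mul, mul_comm q r] at this
  omega

/-- The residue coloring mod `r` is proper on the edges of `F(kr + 1, r)` inside `[kr]`. -/
theorem residue_coloring_proper {r k : ℕ} {e : Finset ℕ} (he : e ∈ Fnr (k * r + 1) r)
    (hsub : e ⊆ Finset.Icc 1 (k * r)) :
    ∃ i ∈ e, ∃ j ∈ e, (i - 1) % r + 1 ≠ (j - 1) % r + 1 := by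
  by_contra! hmono
  refine he.2.2 fun i hi j hj hij => ?_
  exact dist_bounds_of_sub_one_mod_eq (Finset.mem_Icc.1 (hsub hi)).1 hij
    (Finset.mem_Icc.1 (hsub hj)).2 (Nat.succ_injective (hmono i hi j hj))

/-- For `r ≥ 2` and `n = kr + 1` with `k ≥ 1`, the coloring assigning to each
`v ∈ [n-1]` the color `i ∈ {1, ..., r}` with `v ≡ i (mod r)` (namely `i = (v-1) % r + 1`)
is a proper `r`-coloring of the hypergraph induced by `F(n,r)` on `[n-1]`; in particular
`cd_r(F(n,r)) ≤ 1`. -/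
theorem stmt_1 (r k n : ℕ) (hr : 2 ≤ r) (hk : 1 ≤ k) (hn : n = k * r + 1) :
    (∀ v ∈ Finset.Icc 1 (n - 1),
        (v - 1) % r + 1 ∈ Finset.Icc 1 r ∧ ((v - 1) % r + 1) % r = v % r) ∧
    (∀ e ∈ Fnr n r, e ⊆ Finset.Icc 1 (n - 1) →
        ∃ i ∈ e, ∃ j ∈ e, (i - 1) % r + 1 ≠ (j - 1) % r + 1) ∧
    cd r (Finset.Icc 1 n) (Fnr n r) ≤ 1 := by
  subst hn
  rw [Nat.add_sub_cancel]
  have hcolor (v : ℕ) : (v - 1) % r + 1 ∈ Finset.Icc 1 r :=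
    Finset.mem_Icc.2 ⟨Nat.le_add_left _ _, Nat.mod_lt _ (by omega)⟩
  refine ⟨fun v hv => ⟨hcolor v, ?_⟩, fun e he hsub => residue_coloring_proper he hsub, ?_⟩
  · rw [Nat.mod_add_mod, Nat.sub_add_cancel (Finset.mem_Icc.1 hv).1]
  · have hsdiff : Finset.Icc 1 (k * r + 1) \ {k * r + 1} = Finset.Icc 1 (k * r) := by
      ext v
      simp only [Finset.mem_sdiff, Finset.mem_Icc, Finset.mem_singleton]
      omega
    refine Nat.sInf_le ⟨{k * r + 1}, by simp, Finset.card_singleton _,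
      fun v => (v - 1) % r + 1, fun v _ => hcolor v, fun e he => ?_⟩
    exact residue_coloring_proper he.1 (hsdiff ▸ he.2)
end

section
/- Let r ≥ 2 and let n ≥ r be an integer not divisible by r. Let F(n,r) be the set system on ground set [n] consisting of all 2-element subsets of [n] that are not r-stable. Then cd_r(F(n,r)) ≥ 1, i.e. the hypergraph ([n], F(n,r)) admits no proper r-coloring. -/
open Classical

/-- Two points of `[n]` at distance less than `r` or more than `n - r` get different colors in a
proper coloring of `F(n,r)`. -/
theorem Fnr_coloring_ne {n r : ℕ} {c : ℕ → ℕ}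
    (hc : ∀ e ∈ Fnr n r, ∃ i ∈ e, ∃ j ∈ e, c i ≠ c j) {i j : ℕ}
    (hi : 1 ≤ i) (hij : i < j) (hj : j ≤ n) (h : j - i < r ∨ n - r < j - i) : c i ≠ c j := by
  intro heq
  obtain ⟨a, ha, b, hb, hab⟩ := hc {i, j} (by
    refine ⟨?_, Finset.card_pair hij.ne, fun hs => ?_⟩
    · intro x hx
      simp only [Finset.mem_insert, Finset.mem_singleton] at hx
      rw [Finset.mem_Icc]
      omega
    · have := hs i (by simp) j (by simp) hij
      omega)
  simp only [Finset.mem_insert, Finset.mem_singleton] at ha hb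
  rcases ha with rfl | rfl <;> rcases hb with rfl | rfl <;> simp_all

/-- A proper `r`-coloring of `F(n,r)` is `r`-periodic. -/
theorem Fnr_coloring_add {n r : ℕ} {c : ℕ → ℕ}
    (hV : ∀ v ∈ Finset.Icc 1 n, c v ∈ Finset.Icc 1 r)
    (hc : ∀ e ∈ Fnr n r, ∃ i ∈ e, ∃ j ∈ e, c i ≠ c j) {i : ℕ}
    (hi : 1 ≤ i) (hin : i + r ≤ n) : c (i + r) = c i := by
  have hinj : Set.InjOn c (Finset.Icc (i + 1) (i + r)) := by
    intro a ha b hb hab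
    rw [Finset.mem_coe, Finset.mem_Icc] at ha hb
    rcases lt_trichotomy a b with h | h | h
    · exact absurd hab (Fnr_coloring_ne hc (by omega) h (by omega) (by omega))
    · exact h
    · exact absurd hab.symm (Fnr_coloring_ne hc (by omega) h (by omega) (by omega))
  have hmaps : ∀ a ∈ Finset.Icc (i + 1) (i + r), c a ∈ Finset.Icc 1 r := by
    intro a ha
    rw [Finset.mem_Icc] at ha
    exact hV a (Finset.mem_Icc.2 (by omega))
  have hsurj := Finset.surjOn_of_injOn_of_card_le c hmaps hinj (by simp)
  obtain ⟨j, hj, hji⟩ := hsurj (hV i (Finset.mem_Icc.2 (by omega)))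
  rw [Finset.mem_coe, Finset.mem_Icc] at hj
  rcases hj.2.lt_or_eq with h | rfl
  · exact absurd hji.symm (Fnr_coloring_ne hc hi (by omega) (by omega) (by omega))
  · exact hji

theorem not_colorable_Fnr_s4 {n r : ℕ} (hr : 0 < r) (hn : r ≤ n) (hdvd : ¬ r ∣ n) :
    ¬ Colorable (Finset.Icc 1 n) (Fnr n r) r := by
  rintro ⟨c, hV, hc⟩
  have hs : 0 < n % r := Nat.pos_of_ne_zero fun h => hdvd (Nat.dvd_of_mod_eq_zero h)
  have hsr : n % r < r := Nat.mod_lt n hr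
  have hper : ∀ q : ℕ, n % r + r * q ≤ n → c (n % r + r * q) = c (n % r) := by
    intro q
    induction q with
    | zero => simp
    | succ q ih =>
      intro h
      rw [Nat.mul_succ, ← add_assoc] at h ⊢
      rw [Fnr_coloring_add hV hc (by omega) h]
      exact ih (by omega)
  have hdiv := Nat.mod_add_div n r
  have heq := hper (n / r) hdiv.le
  rw [hdiv] at heq
  exact Fnr_coloring_ne hc hs (by omega) le_rfl (Or.inr (by omega)) heq.symm

/-- For `r ≥ 2` and `n ≥ r` not divisible by `r`, `cd_r(F(n,r)) ≥ 1`,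
i.e. the hypergraph `([n], F(n,r))` admits no proper `r`-coloring. -/
theorem stmt_4 (r n : ℕ) (hr : 2 ≤ r) (hn : r ≤ n) (hdvd : ¬ r ∣ n) :
    1 ≤ cd r (Finset.Icc 1 n) (Fnr n r) ∧
    ¬ Colorable (Finset.Icc 1 n) (Fnr n r) r := by
  have hnot := not_colorable_Fnr_s4 (by omega) hn hdvd
  refine ⟨?_, hnot⟩
  rw [Nat.one_le_iff_ne_zero]
  intro h0
  rcases Nat.sInf_eq_zero.1 h0 with ⟨B, -, hB, c, hV, hc⟩ | hempty
  · rw [Finset.card_eq_zero] at hB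
    subst hB
    rw [Finset.sdiff_empty] at hV hc
    exact hnot ⟨c, hV, fun e he => hc e ⟨he, he.1⟩⟩
  · refine Set.eq_empty_iff_forall_notMem.1 hempty (Finset.Icc 1 n).card
      ⟨_, Finset.Subset.rfl, rfl, id, by simp, ?_⟩
    rintro e ⟨⟨-, hcard, -⟩, he⟩
    rw [Finset.sdiff_self, Finset.subset_empty] at he
    simp [he] at hcard
end

section
/- Let r ≥ 2, n = r(2r−1), and let F be the set system on [n] defined as F = F(n,r) ∪ {{1+ir, 1+(i+1)r} : i = 0,...,2r−3} ∪ {{(2r−2)r+1, 1}}, where F(n,r) is the set of all 2-element subsets of [n] that are not r-stable. Then χ(KG^r(F_{r-stab})) = 1. -/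
open Classical

/-- Fewer than `2 * r` points cannot support `r` pairwise disjoint two-element sets, so a
constant coloring of the pairs is proper. -/
theorem kgColorable_one_of_pairs {r : ℕ} {F : Set (Finset ℕ)} (V : Finset ℕ)
    (hV : V.card < r * 2) (hF : ∀ A ∈ F, A ⊆ V ∧ A.card = 2) : KGColorable r F 1 := by
  refine ⟨fun _ => 1, by simp, fun E hE hEF hdisj => ?_⟩
  have hcard : (E.biUnion fun A => A).card = r * 2 := by
    rw [Finset.card_biUnion (fun A hA B hB h => hdisj A hA B hB h),
      Finset.sum_const_nat (fun A hA => (hF A (hEF hA)).2), hE]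
  have hle := Finset.card_le_card
    (Finset.biUnion_subset.mpr fun A hA => (hF A (hEF hA)).1 : (E.biUnion fun A => A) ⊆ V)
  omega

theorem not_kgColorable_zero {r : ℕ} {F : Set (Finset ℕ)} (hF : F.Nonempty) :
    ¬ KGColorable r F 0 := by
  rintro ⟨c, hc, -⟩
  obtain ⟨A, hA⟩ := hF
  simpa using hc A hA

theorem chiKG_eq_one {r : ℕ} {F : Set (Finset ℕ)} (h0 : ¬ KGColorable r F 0)
    (h1 : KGColorable r F 1) : chiKG r F = 1 := by
  refine le_antisymm (Nat.sInf_le h1) (Nat.one_le_iff_ne_zero.mpr fun h => ?_)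
  rcases Nat.sInf_eq_zero.mp h with h | h
  · exact h0 h
  · exact Set.notMem_empty 1 (h ▸ h1)

theorem Gfam_pair {r : ℕ} (hr : 2 ≤ r) {A : Finset ℕ} (hA : A ∈ Gfam r) :
    A ⊆ (Finset.range (2 * r - 1)).image (fun i => 1 + i * r) ∧ A.card = 2 := by
  rcases hA with ⟨i, hi, rfl⟩ | rfl
  · refine ⟨?_, Finset.card_pair ?_⟩
    · simp only [Finset.insert_subset_iff, Finset.singleton_subset_iff, Finset.mem_image,
        Finset.mem_range]
      exact ⟨⟨i, by omega, rfl⟩, ⟨i + 1, by omega, rfl⟩⟩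
    · rw [add_mul]
      omega
  · refine ⟨?_, Finset.card_pair ?_⟩
    · simp only [Finset.insert_subset_iff, Finset.singleton_subset_iff, Finset.mem_image,
        Finset.mem_range]
      exact ⟨⟨2 * r - 2, by omega, by omega⟩, ⟨0, by omega, by omega⟩⟩
    · have : 0 < (2 * r - 2) * r := Nat.mul_pos (by omega) (by omega)
      omega

/-- For `r ≥ 2` and `n = r(2r - 1)`, with `F = F(n,r) ∪ G` where
`G = {{1+ir, 1+(i+1)r} : i = 0, ..., 2r-3} ∪ {{(2r-2)r+1, 1}}`, one has
`χ(KG^r(F_{r-stab})) = 1`. -/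
theorem stmt_8 (r n : ℕ) (hr : 2 ≤ r) (hn : n = r * (2 * r - 1)) :
    chiKG r (rStabPart n r (Fnr n r ∪ Gfam r)) = 1 := by
  refine chiKG_eq_one (not_kgColorable_zero ⟨{1, 1 + r}, ?_, ?_⟩)
    (kgColorable_one_of_pairs ((Finset.range (2 * r - 1)).image (fun i => 1 + i * r)) ?_ ?_)
  · exact Or.inr (Or.inl ⟨0, by omega, by simp⟩)
  · have h : r * 2 ≤ n := hn ▸ Nat.mul_le_mul_left r (by omega)
    intro i hi j hj hij
    simp only [Finset.mem_insert, Finset.mem_singleton] at hi hj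
    omega
  · refine Finset.card_image_le.trans_lt ?_
    rw [Finset.card_range]
    omega
  · rintro A ⟨hA | hA, hst⟩
    · exact absurd hst hA.2.2
    · exact Gfam_pair hr hA
end

section
/- Let r ≥ 2, n = r(2r−1), and let F be the set system on [n] defined as F = F(n,r) ∪ {{1+ir, 1+(i+1)r} : i = 0,...,2r−3} ∪ {{(2r−2)r+1, 1}}, where F(n,r) is the set of all 2-element subsets of [n] that are not r-stable. Then cd_r(F) ≥ r: for every set B ⊆ [n] with |B| ≤ r−1, the hypergraph induced by F on [n]∖B admits no proper r-coloring. -/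
open Classical

/-- A pair of elements of `[n]` at distance less than `r`, or more than `n - r`, belongs to
`F(n,r)`. -/
lemma pair_mem_Fnr_s9 {n r u v : ℕ} (hu : 1 ≤ u) (huv : u < v) (hv : v ≤ n)
    (h : v - u < r ∨ n - r < v - u) : ({u, v} : Finset ℕ) ∈ Fnr n r := by
  refine ⟨?_, Finset.card_pair huv.ne, fun hs => ?_⟩
  · intro x hx
    simp only [Finset.mem_insert, Finset.mem_singleton] at hx
    rw [Finset.mem_Icc]
    omega
  · have := hs u (by simp) v (by simp) huv
    omega

/-- The `i`-th window of `r + 1` cyclically consecutive elements of `[r(2r-1)]`, starting at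
`1 + i * r`. -/
def window (r i : ℕ) : Finset ℕ :=
  if i = 2 * r - 2 then insert 1 (Finset.Icc (1 + i * r) (i * r + r))
  else Finset.Icc (1 + i * r) (1 + i * r + r)

lemma card_window {r i : ℕ} (hr : 2 ≤ r) : (window r i).card = r + 1 := by
  unfold window
  split_ifs with h
  · rw [Finset.card_insert_of_notMem, Nat.card_Icc]
    · omega
    · have : 0 < i * r := Nat.mul_pos (by omega) (by omega)
      rw [Finset.mem_Icc]
      omega
  · rw [Nat.card_Icc]
    omega

lemma window_subset {r n i : ℕ} (hr : 2 ≤ r) (hn : n = (2 * r - 2) * r + r)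
    (hi : i ≤ 2 * r - 2) : window r i ⊆ Finset.Icc 1 n := by
  intro x hx
  unfold window at hx
  rw [Finset.mem_Icc]
  split_ifs at hx with h
  · rw [Finset.mem_insert, Finset.mem_Icc] at hx
    subst h
    omega
  · rw [Finset.mem_Icc] at hx
    have : (i + 1) * r ≤ (2 * r - 2) * r := Nat.mul_le_mul_right r (by omega)
    rw [add_one_mul] at this
    omega

/-- Every window is a clique of `F(n,r) ∪ G`. -/
lemma pair_mem_of_mem_window {r n i u v : ℕ} (hr : 2 ≤ r) (hn : n = (2 * r - 2) * r + r)
    (hi : i ≤ 2 * r - 2) (hu : u ∈ window r i) (hv : v ∈ window r i) (huv : u < v) :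
    ({u, v} : Finset ℕ) ∈ Fnr n r ∪ Gfam r := by
  have hu1 := (Finset.mem_Icc.1 (window_subset hr hn hi hu)).1
  have hvn := (Finset.mem_Icc.1 (window_subset hr hn hi hv)).2
  by_cases hF : v - u < r ∨ n - r < v - u
  · exact Or.inl (pair_mem_Fnr_s9 hu1 huv hvn hF)
  right
  unfold window at hu hv
  split_ifs at hu hv with h
  · right
    rw [Finset.mem_insert, Finset.mem_Icc] at hu hv
    subst h
    obtain rfl : u = 1 := by omega
    obtain rfl : v = (2 * r - 2) * r + 1 := by omega
    exact Finset.pair_comm _ _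
  · rw [Finset.mem_Icc] at hu hv
    refine Or.inl ⟨i, by omega, ?_⟩
    obtain rfl : u = 1 + i * r := by omega
    obtain rfl : v = 1 + i * r + r := by omega
    rw [add_one_mul, add_assoc]

/-- Every element lies in at most two windows. -/
lemma card_filter_mem_window_le (r x : ℕ) (hr : 2 ≤ r) :
    ((Finset.range (2 * r - 1)).filter fun i => x ∈ window r i).card ≤ 2 := by
  refine (Finset.card_le_card (t := {(x - 1) / r,
    if x = 1 then 2 * r - 2 else (x - 1) / r - 1}) fun i hi => ?_).trans Finset.card_le_two
  obtain ⟨-, hi⟩ := Finset.mem_filter.1 hi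
  have hdiv (hx : 1 + i * r ≤ x) (hx' : x < 1 + i * r + r) : i = (x - 1) / r := by
    symm
    rw [Nat.div_eq_iff (by omega)]
    omega
  rw [Finset.mem_insert, Finset.mem_singleton]
  unfold window at hi
  split_ifs at hi with h
  · rw [Finset.mem_insert, Finset.mem_Icc] at hi
    rcases hi with rfl | hi
    · exact Or.inr (by simp [h])
    · exact Or.inl (hdiv (by omega) (by omega))
  · rw [Finset.mem_Icc] at hi
    by_cases hx : x < 1 + i * r + r
    · exact Or.inl (hdiv hi.1 hx)
    · right
      have hxi : x - 1 = (i + 1) * r := by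
        rw [add_one_mul]
        omega
      rw [if_neg (by omega), hxi, Nat.mul_div_cancel _ (by omega), Nat.add_sub_cancel]

/-- A set meeting all `2r - 1` windows has at least `r` elements. -/
lemma exists_window_disjoint {r : ℕ} {B : Finset ℕ} (hr : 2 ≤ r) (hB : B.card ≤ r - 1) :
    ∃ i ≤ 2 * r - 2, Disjoint (window r i) B := by
  by_contra! hmeet
  have hmeet' (i : ℕ) : ∃ b, i ∈ Finset.range (2 * r - 1) → b ∈ window r i ∧ b ∈ B := by
    by_cases hi : i ∈ Finset.range (2 * r - 1)
    · obtain ⟨b, hb⟩ := Finset.not_disjoint_iff.1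
        (hmeet i (by rw [Finset.mem_range] at hi; omega))
      exact ⟨b, fun _ => hb⟩
    · exact ⟨0, fun h => absurd h hi⟩
  choose f hf using hmeet'
  obtain ⟨b, -, hb⟩ := Finset.exists_lt_card_fiber_of_mul_lt_card_of_maps_to
    (s := Finset.range (2 * r - 1)) (t := B) (n := 2) (fun i hi => (hf i hi).2)
    (by rw [Finset.card_range]; omega)
  refine absurd (hb.trans_le (Finset.card_le_card fun i hi => ?_))
    (card_filter_mem_window_le r b hr).not_gt
  obtain ⟨hir, rfl⟩ := Finset.mem_filter.1 hi
  exact Finset.mem_filter.2 ⟨hir, (hf i hir).1⟩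

/-- A hypergraph containing all pairs of a vertex set `K` with more than `m` elements is not
`m`-colorable. -/
lemma not_colorable_of_clique {V K : Finset ℕ} {E : Set (Finset ℕ)} {m : ℕ} (hKV : K ⊆ V)
    (hK : m < K.card) (hE : ∀ u ∈ K, ∀ v ∈ K, u < v → ({u, v} : Finset ℕ) ∈ E) :
    ¬ Colorable V E m := by
  rintro ⟨c, hc, hcE⟩
  obtain ⟨u, hu, v, hv, huv, heq⟩ := Finset.exists_ne_map_eq_of_card_lt_of_maps_to
    (s := K) (t := Finset.Icc 1 m) (by simpa using hK) (fun x hx => hc x (hKV hx))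
  wlog hlt : u < v generalizing u v
  · exact this v hv u hu huv.symm heq.symm (by omega)
  obtain ⟨i, hi, j, hj, hij⟩ := hcE _ (hE u hu v hv hlt)
  simp only [Finset.mem_insert, Finset.mem_singleton] at hi hj
  rcases hi with rfl | rfl <;> rcases hj with rfl | rfl <;> simp_all

lemma nonempty_of_mem_Fnr_union_Gfam {n r : ℕ} {e : Finset ℕ} (he : e ∈ Fnr n r ∪ Gfam r) :
    e.Nonempty := by
  rcases he with ⟨-, he, -⟩ | ⟨i, -, rfl⟩ | rfl
  · exact Finset.card_pos.1 (by omega)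
  · exact Finset.insert_nonempty _ _
  · exact Finset.insert_nonempty _ _

/-- For `r ≥ 2` and `n = r(2r - 1)`, with `F = F(n,r) ∪ G`, one has
`cd_r(F) ≥ r`: for every `B ⊆ [n]` with `|B| ≤ r - 1`, the hypergraph induced by `F`
on `[n] ∖ B` admits no proper `r`-coloring. -/
theorem stmt_9 (r n : ℕ) (hr : 2 ≤ r) (hn : n = r * (2 * r - 1)) :
    r ≤ cd r (Finset.Icc 1 n) (Fnr n r ∪ Gfam r) ∧
    ∀ B : Finset ℕ, B ⊆ Finset.Icc 1 n → B.card ≤ r - 1 →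
      ¬ Colorable (Finset.Icc 1 n \ B)
        {e ∈ Fnr n r ∪ Gfam r | e ⊆ Finset.Icc 1 n \ B} r := by
  have hn' : n = (2 * r - 2) * r + r := by
    rw [hn, ← add_one_mul, mul_comm]
    congr 1
    omega
  have hmain : ∀ B : Finset ℕ, B ⊆ Finset.Icc 1 n → B.card ≤ r - 1 →
      ¬ Colorable (Finset.Icc 1 n \ B)
        {e ∈ Fnr n r ∪ Gfam r | e ⊆ Finset.Icc 1 n \ B} r := by
    intro B _ hB
    obtain ⟨i, hi, hdisj⟩ := exists_window_disjoint hr hB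
    have hsub : window r i ⊆ Finset.Icc 1 n \ B :=
      Finset.subset_sdiff.2 ⟨window_subset hr hn' hi, hdisj⟩
    refine not_colorable_of_clique hsub (by rw [card_window hr]; omega) fun u hu v hv huv => ?_
    exact ⟨pair_mem_of_mem_window hr hn' hi hu hv huv,
      Finset.insert_subset (hsub hu) (Finset.singleton_subset_iff.2 (hsub hv))⟩
  refine ⟨le_csInf ⟨_, Finset.Icc 1 n, subset_rfl, rfl, fun _ => 0, by simp, ?_⟩ ?_, hmain⟩
  · rintro e ⟨he, hsub⟩
    rw [Finset.sdiff_self, Finset.subset_empty] at hsub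
    exact absurd hsub (nonempty_of_mem_Fnr_union_Gfam he).ne_empty
  · rintro b ⟨B, hBV, rfl, hcol⟩
    by_contra hlt
    exact hmain B hBV (by omega) hcol
end

section
/- Let r ≥ 2, n = r(2r−1), and for 0 ≤ i ≤ 2r−3 let A_i = {1+ir, 2+ir, ..., 1+(i+1)r} ⊆ [n]. If B ⊆ [n] has |B| = r−1 and B contains at least one element of each A_i for i = 0,...,2r−3, then B = {1+r, 1+3r, ..., 1+(2r−3)r}, i.e. B = {1+(2j−1)r : j = 1,...,r−1}. -/
open Classical

/-- A choice of one point from each of the intervals `{1 + ir, ..., 1 + (i+1)r}` with `i = 2j + c`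
is strictly increasing in `j`. -/
theorem strictMono_of_mem_Icc_alternate {r m c : ℕ} (hr : 0 < r) {f : Fin m → ℕ}
    (hf : ∀ j : Fin m,
      f j ∈ Finset.Icc (1 + (2 * (j : ℕ) + c) * r) (1 + (2 * (j : ℕ) + c + 1) * r)) :
    StrictMono f := by
  intro a b hab
  have ha := (Finset.mem_Icc.1 (hf a)).2
  have hb := (Finset.mem_Icc.1 (hf b)).1
  have hab' : (a : ℕ) < b := hab
  have hlt : (2 * (a : ℕ) + c + 1) * r < (2 * (b : ℕ) + c) * r :=
    Nat.mul_lt_mul_of_pos_right (by omega) hr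
  omega

/-- For `r ≥ 2` and `n = r(2r - 1)`, if `B ⊆ [n]` has `|B| = r - 1` and meets
each `A_i = {1+ir, ..., 1+(i+1)r}` for `0 ≤ i ≤ 2r - 3`, then
`B = {1+r, 1+3r, ..., 1+(2r-3)r} = {1+(2j-1)r : j = 1, ..., r-1}`. -/
theorem stmt_11 (r n : ℕ) (hr : 2 ≤ r) (hn : n = r * (2 * r - 1))
    (B : Finset ℕ) (hB : B ⊆ Finset.Icc 1 n) (hcard : B.card = r - 1)
    (hmeet : ∀ i, i ≤ 2 * r - 3 →
      (B ∩ Finset.Icc (1 + i * r) (1 + (i + 1) * r)).Nonempty) :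
    B = Finset.image (fun j => 1 + (2 * j - 1) * r) (Finset.Icc 1 (r - 1)) := by
  have hpos : 0 < r := by omega
  choose f hf using fun j : Fin (r - 1) => hmeet (2 * (j : ℕ) + 0) (by omega)
  choose g hg using fun j : Fin (r - 1) => hmeet (2 * (j : ℕ) + 1) (by omega)
  simp only [Finset.mem_inter] at hf hg
  have hf_eq := Finset.orderEmbOfFin_unique hcard (fun j => (hf j).1)
    (strictMono_of_mem_Icc_alternate hpos fun j => (hf j).2)
  have hg_eq := Finset.orderEmbOfFin_unique hcard (fun j => (hg j).1)
    (strictMono_of_mem_Icc_alternate hpos fun j => (hg j).2)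
  have hval : ∀ j : Fin (r - 1), B.orderEmbOfFin hcard j = 1 + (2 * (j : ℕ) + 1) * r := by
    intro j
    have h₁ := (Finset.mem_Icc.1 (hf j).2).2
    have h₂ := (Finset.mem_Icc.1 (hg j).2).1
    rw [hf_eq] at h₁
    rw [hg_eq] at h₂
    exact le_antisymm h₁ h₂
  ext x
  rw [← Finset.mem_coe, ← Finset.range_orderEmbOfFin B hcard]
  simp only [Set.mem_range, hval, Finset.mem_image, Finset.mem_Icc]
  constructor
  · rintro ⟨j, rfl⟩
    refine ⟨j + 1, by omega, ?_⟩
    rw [show 2 * ((j : ℕ) + 1) - 1 = 2 * (j : ℕ) + 1 by omega]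
  · rintro ⟨j, hj, rfl⟩
    refine ⟨⟨j - 1, by omega⟩, ?_⟩
    rw [show 2 * j - 1 = 2 * (j - 1) + 1 by omega]
end

section
/- Let r ≥ 3 and n = r(2r−1), and let F be the set system on [n] defined as F = F(n,r) ∪ {{1+ir, 1+(i+1)r} : i = 0,...,2r−3} ∪ {{(2r−2)r+1, 1}}, where F(n,r) is the set of all 2-element subsets of [n] that are not r-stable. Then F_{r-stab} ≠ ∅ and χ(KG^r(F_{r-stab})) < ⌈cd_r(F)/(r−1)⌉; indeed χ(KG^r(F_{r-stab})) = 1 while ⌈cd_r(F)/(r−1)⌉ ≥ 2. -/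
open Classical

/-- Every member of `G` is a pair of vertices from `{1 + i * r : i < 2 * r - 1}`. -/
lemma Gfam_subset_and_card {r : ℕ} (hr : 3 ≤ r) {σ : Finset ℕ} (hσ : σ ∈ Gfam r) :
    σ ⊆ (Finset.range (2 * r - 1)).image (fun i => 1 + i * r) ∧ σ.card = 2 := by
  rcases hσ with ⟨i, hi, rfl⟩ | hσ
  · constructor
    · intro x hx
      simp only [Finset.mem_insert, Finset.mem_singleton] at hx
      simp only [Finset.mem_image, Finset.mem_range]
      rcases hx with rfl | rfl
      · exact ⟨i, by omega, rfl⟩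
      · exact ⟨i + 1, by omega, rfl⟩
    · apply Finset.card_pair
      rw [add_mul]
      omega
  · rw [Set.mem_singleton_iff] at hσ
    subst hσ
    constructor
    · intro x hx
      simp only [Finset.mem_insert, Finset.mem_singleton] at hx
      simp only [Finset.mem_image, Finset.mem_range]
      rcases hx with rfl | rfl
      · exact ⟨2 * r - 2, by omega, by omega⟩
      · exact ⟨0, by omega, by omega⟩
    · apply Finset.card_pair
      have : 0 < (2 * r - 2) * r := Nat.mul_pos (by omega) (by omega)
      omega

lemma rStabPart_subset_Gfam (n r : ℕ) : rStabPart n r (Fnr n r ∪ Gfam r) ⊆ Gfam r := by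
  rintro σ ⟨h | h, hs⟩
  · exact absurd hs h.2.2
  · exact h

/-- The ground set size `r * (2 * r - 1)` is `r` more than the largest vertex offset in `G`. -/
lemma cycle_length_eq {r : ℕ} (hr : 3 ≤ r) : r * (2 * r - 1) = (2 * r - 2) * r + r := by
  obtain ⟨k, rfl⟩ := Nat.exists_eq_add_of_le hr
  have h1 : 2 * (3 + k) - 1 = 2 * k + 5 := by omega
  have h2 : 2 * (3 + k) - 2 = 2 * k + 4 := by omega
  rw [h1, h2]
  ring

lemma rStabPart_nonempty {r n : ℕ} (hr : 3 ≤ r) (hn : n = r * (2 * r - 1)) :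
    (rStabPart n r (Fnr n r ∪ Gfam r)).Nonempty := by
  rw [cycle_length_eq hr] at hn
  have h4 : 4 * r ≤ (2 * r - 2) * r := Nat.mul_le_mul_right r (by omega)
  refine ⟨{1 + 0 * r, 1 + (0 + 1) * r}, Or.inr (Or.inl ⟨0, by omega, rfl⟩), ?_⟩
  intro i hi j hj hij
  simp only [Finset.mem_insert, Finset.mem_singleton] at hi hj
  omega

lemma KGColorable_one_rStabPart {r : ℕ} (n : ℕ) (hr : 3 ≤ r) :
    KGColorable r (rStabPart n r (Fnr n r ∪ Gfam r)) 1 := by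
  refine ⟨fun _ => 1, fun _ _ => by simp, fun E hE hEF hdisj => ?_⟩
  exfalso
  have hG : ∀ A ∈ E, A ⊆ (Finset.range (2 * r - 1)).image (fun i => 1 + i * r) ∧ A.card = 2 :=
    fun A hA => Gfam_subset_and_card hr (rStabPart_subset_Gfam n r (hEF hA))
  have hcard : (E.biUnion id).card = ∑ A ∈ E, A.card :=
    Finset.card_biUnion fun A hA B hB hAB => hdisj A hA B hB hAB
  rw [Finset.sum_const_nat fun A hA => (hG A hA).2, hE] at hcard
  have hle := (Finset.card_le_card (Finset.biUnion_subset.2 fun A hA => (hG A hA).1 :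
    E.biUnion id ⊆ _)).trans Finset.card_image_le
  rw [hcard, Finset.card_range] at hle
  omega

lemma chiKG_rStabPart {r n : ℕ} (hr : 3 ≤ r) (hn : n = r * (2 * r - 1)) :
    chiKG r (rStabPart n r (Fnr n r ∪ Gfam r)) = 1 := by
  refine le_antisymm (Nat.sInf_le (KGColorable_one_rStabPart n hr)) ?_
  refine le_csInf ⟨1, KGColorable_one_rStabPart n hr⟩ ?_
  rintro m ⟨c, hc, -⟩
  obtain ⟨A, hA⟩ := rStabPart_nonempty hr hn
  have := Finset.mem_Icc.1 (hc A hA)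
  omega

/-- A clique on more than `m` vertices rules out proper `m`-colorings. -/
lemma not_colorable_of_clique_s12 {V : Finset ℕ} {F : Set (Finset ℕ)} {m : ℕ} {W : Finset ℕ}
    (hWV : W ⊆ V) (hW : m < W.card) (hF : ∀ x ∈ W, ∀ y ∈ W, x < y → ({x, y} : Finset ℕ) ∈ F) :
    ¬ Colorable V {e ∈ F | e ⊆ V} m := by
  rintro ⟨c, hc, he⟩
  obtain ⟨x, hx, y, hy, hxy, hcxy⟩ := Finset.exists_ne_map_eq_of_card_lt_of_maps_to
    (t := Finset.Icc 1 m) (by simpa using hW) (fun v hv => hc v (hWV hv))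
  wlog hlt : x < y generalizing x y
  · exact this y hy x hx hxy.symm hcxy.symm (by omega)
  obtain ⟨i, hi, j, hj, hij⟩ := he {x, y} ⟨hF x hx y hy hlt, by
    intro z hz
    simp only [Finset.mem_insert, Finset.mem_singleton] at hz
    rcases hz with rfl | rfl
    · exact hWV hx
    · exact hWV hy⟩
  simp only [Finset.mem_insert, Finset.mem_singleton] at hi hj
  rcases hi with rfl | rfl <;> rcases hj with rfl | rfl <;> simp_all

lemma pair_mem_Fnr_s12 {n r x y : ℕ} (hx : 1 ≤ x) (hxy : x < y) (hy : y ≤ n)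
    (h : y - x < r ∨ n - r < y - x) : ({x, y} : Finset ℕ) ∈ Fnr n r := by
  refine ⟨?_, Finset.card_pair hxy.ne, fun hs => ?_⟩
  · intro z hz
    simp only [Finset.mem_insert, Finset.mem_singleton] at hz
    rw [Finset.mem_Icc]
    omega
  · have := hs x (by simp) y (by simp) hxy
    omega

/-- The `i`-th closed arc of `r + 1` cyclically consecutive vertices between neighbours in `G`. -/
def arc (r i : ℕ) : Finset ℕ :=
  if i ≤ 2 * r - 3 then Finset.Icc (1 + i * r) (1 + (i + 1) * r)
  else insert 1 (Finset.Icc (1 + (2 * r - 2) * r) ((2 * r - 2) * r + r))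

lemma card_arc {r : ℕ} (hr : 3 ≤ r) (i : ℕ) : (arc r i).card = r + 1 := by
  unfold arc
  split_ifs
  · rw [Nat.card_Icc, add_mul]
    omega
  · have : 0 < (2 * r - 2) * r := Nat.mul_pos (by omega) (by omega)
    rw [Finset.card_insert_of_notMem, Nat.card_Icc]
    · omega
    · rw [Finset.mem_Icc]
      omega

lemma arc_subset {r : ℕ} (hr : 3 ≤ r) (i : ℕ) :
    arc r i ⊆ Finset.Icc 1 ((2 * r - 2) * r + r) := by
  intro x hx
  rw [Finset.mem_Icc]
  unfold arc at hx
  split_ifs at hx with h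
  · have : (i + 1) * r ≤ (2 * r - 2) * r := Nat.mul_le_mul_right r (by omega)
    rw [Finset.mem_Icc] at hx
    omega
  · rw [Finset.mem_insert, Finset.mem_Icc] at hx
    omega

lemma arc_clique {r : ℕ} (hr : 3 ≤ r) (i x y : ℕ) (hx : x ∈ arc r i)
    (hy : y ∈ arc r i) (hxy : x < y) :
    ({x, y} : Finset ℕ) ∈ Fnr ((2 * r - 2) * r + r) r ∪ Gfam r := by
  have hx1 := Finset.mem_Icc.1 (arc_subset hr i hx)
  have hy1 := Finset.mem_Icc.1 (arc_subset hr i hy)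
  by_cases hF : y - x < r ∨ (2 * r - 2) * r + r - r < y - x
  · exact Or.inl (pair_mem_Fnr_s12 hx1.1 hxy hy1.2 hF)
  right
  unfold arc at hx hy
  split_ifs at hx hy with h
  · rw [Finset.mem_Icc] at hx hy
    have hmul : (i + 1) * r = i * r + r := by ring
    obtain rfl : x = 1 + i * r := by omega
    obtain rfl : y = 1 + (i + 1) * r := by omega
    exact Or.inl ⟨i, h, rfl⟩
  · rw [Finset.mem_insert, Finset.mem_Icc] at hx hy
    obtain rfl : x = 1 := by omega
    obtain rfl : y = (2 * r - 2) * r + 1 := by omega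
    right
    rw [Set.mem_singleton_iff, Finset.pair_comm]

/-- Every vertex lies in at most two arcs. -/
lemma eq_or_eq_of_mem_arc {r i v : ℕ} (hr : 3 ≤ r) (hi : i < 2 * r - 1) (hv : v ∈ arc r i) :
    i = (v - 1) / r ∨ i = if (v - 1) / r = 0 then 2 * r - 2 else (v - 1) / r - 1 := by
  have hmul : (i + 1) * r = i * r + r := by ring
  have hr0 : 0 < r := by omega
  unfold arc at hv
  split_ifs at hv with h
  · rw [Finset.mem_Icc] at hv
    by_cases hlt : v - 1 < (i + 1) * r
    · left
      exact (Nat.div_eq_of_lt_le (by omega) hlt).symm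
    · right
      have : v - 1 = (i + 1) * r := by omega
      rw [this, Nat.mul_div_cancel _ hr0]
      simp
  · obtain rfl : i = 2 * r - 2 := by omega
    rw [Finset.mem_insert, Finset.mem_Icc] at hv
    rcases hv with rfl | hv
    · right
      simp
    · left
      exact (Nat.div_eq_of_lt_le (by omega) (by omega)).symm

lemma le_card_of_colorable_sdiff {r : ℕ} (hr : 3 ≤ r) {B : Finset ℕ}
    (hB : Colorable (Finset.Icc 1 ((2 * r - 2) * r + r) \ B)
      {e ∈ Fnr ((2 * r - 2) * r + r) r ∪ Gfam r |
        e ⊆ Finset.Icc 1 ((2 * r - 2) * r + r) \ B} r) :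
    r ≤ B.card := by
  have hmeet : ∀ i, ∃ v ∈ B, v ∈ arc r i := by
    intro i
    by_contra! hdis
    refine not_colorable_of_clique_s12 (W := arc r i) (fun v hv => ?_) (by rw [card_arc hr]; omega)
      (fun x hx y hy => arc_clique hr i x y hx hy) hB
    exact Finset.mem_sdiff.2 ⟨arc_subset hr i hv, fun hvB => hdis v hvB hv⟩
  choose f hfB hf using hmeet
  have hcard := Finset.card_le_mul_card_image_of_maps_to (s := Finset.range (2 * r - 1)) (t := B)
    (f := f) (fun i _ => hfB i) 2 (fun v _ => by
      refine (Finset.card_le_card (t := {(v - 1) / r,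
        if (v - 1) / r = 0 then 2 * r - 2 else (v - 1) / r - 1}) ?_).trans Finset.card_le_two
      intro i hi
      rw [Finset.mem_filter, Finset.mem_range] at hi
      rw [Finset.mem_insert, Finset.mem_singleton]
      exact eq_or_eq_of_mem_arc hr hi.1 (hi.2 ▸ hf i))
  rw [Finset.card_range] at hcard
  omega

lemma le_cd {r n : ℕ} (hr : 3 ≤ r) (hn : n = r * (2 * r - 1)) :
    r ≤ cd r (Finset.Icc 1 n) (Fnr n r ∪ Gfam r) := by
  rw [cycle_length_eq hr] at hn
  subst hn
  refine le_csInf ⟨_, _, Finset.Subset.refl _, rfl, fun _ => 1, by simp, ?_⟩ ?_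
  · rintro e ⟨he, hsub⟩
    rw [sdiff_self, Finset.bot_eq_empty, Finset.subset_empty] at hsub
    have hcard : e.card = 2 := he.elim (fun h => h.2.1) (fun h => (Gfam_subset_and_card hr h).2)
    simp [hsub] at hcard
  · rintro b ⟨B, -, rfl, hcol⟩
    exact le_card_of_colorable_sdiff hr hcol

/-- For `r ≥ 3` and `n = r(2r - 1)`, the family `F = F(n,r) ∪ G` satisfies
`F_{r-stab} ≠ ∅` and `χ(KG^r(F_{r-stab})) < ⌈cd_r(F) / (r-1)⌉`; indeed
`χ(KG^r(F_{r-stab})) = 1` while `⌈cd_r(F) / (r-1)⌉ ≥ 2`. -/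
theorem stmt_12 (r n : ℕ) (hr : 3 ≤ r) (hn : n = r * (2 * r - 1)) :
    rStabPart n r (Fnr n r ∪ Gfam r) ≠ ∅ ∧
    chiKG r (rStabPart n r (Fnr n r ∪ Gfam r)) = 1 ∧
    2 ≤ cd r (Finset.Icc 1 n) (Fnr n r ∪ Gfam r) ⌈/⌉ (r - 1) ∧
    chiKG r (rStabPart n r (Fnr n r ∪ Gfam r)) <
      cd r (Finset.Icc 1 n) (Fnr n r ∪ Gfam r) ⌈/⌉ (r - 1) := by
  have hcd : 2 ≤ cd r (Finset.Icc 1 n) (Fnr n r ∪ Gfam r) ⌈/⌉ (r - 1) := by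
    by_contra! hlt
    have hle := (ceilDiv_le_iff_le_mul (show 0 < r - 1 by omega)).1 (Nat.lt_succ_iff.1 hlt)
    have := le_cd hr hn
    omega
  refine ⟨(rStabPart_nonempty hr hn).ne_empty, chiKG_rStabPart hr hn, hcd, ?_⟩
  rw [chiKG_rStabPart hr hn]
  omega
end

section
/- Let r ≥ 2 and let F be any set system on ground set [n]. Then χ(KG^r(F_{~r-stab})) ≤ χ(KG^r(F_{r-stab})) + 1: given any proper coloring c of KG^r(F_{r-stab}) with m colors, the extension c′ which equals c on F_{r-stab} and assigns one fixed new color ∗ to every member of F_{~r-stab} ∖ F_{r-stab} is a proper (m+1)-coloring of KG^r(F_{~r-stab}). -/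
open Classical

/-- Among `r` pairwise disjoint almost `r`-stable subsets of `[n]`, at least one is `r`-stable:
a subset that is not has an element in `[r - 1]`. -/
theorem exists_rStable_of_card_eq (r n : ℕ) (hr : 0 < r) (E : Finset (Finset ℕ))
    (hE : E.card = r) (hn : ∀ A ∈ E, A ⊆ Finset.Icc 1 n) (ha : ∀ A ∈ E, almostRStable r A)
    (hd : ∀ A ∈ E, ∀ B ∈ E, A ≠ B → Disjoint A B) : ∃ A ∈ E, rStable n r A := by
  by_contra! hs
  have small : ∀ A ∈ E, ∃ i ∈ A, i ∈ Finset.Icc 1 (r - 1) := by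
    intro A hA
    have h := hs A hA
    simp only [rStable, not_forall] at h
    obtain ⟨i, hi, j, hj, hij, h⟩ := h
    have h1 := ha A hA i hi j hj hij
    have h2 := Finset.mem_Icc.1 (hn A hA hi)
    have h3 := Finset.mem_Icc.1 (hn A hA hj)
    exact ⟨i, hi, Finset.mem_Icc.2 (by omega)⟩
  choose! f hf hf' using small
  have hinj : Set.InjOn f E := by
    intro A hA B hB hAB
    by_contra hne
    exact Finset.disjoint_left.1 (hd A hA B hB hne) (hf A hA) (hAB ▸ hf B hB)
  have hcard := Finset.card_le_card_of_injOn f hf' hinj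
  rw [hE, Nat.card_Icc] at hcard
  omega

/-- Coloring the almost `r`-stable, non-`r`-stable members with one new color extends a proper
coloring of the `r`-stable members. -/
theorem extension_proper (r n : ℕ) (hr : 0 < r)
    (F : Set (Finset ℕ)) (hF : ∀ A ∈ F, A ⊆ Finset.Icc 1 n) (m : ℕ) (c : Finset ℕ → ℕ)
    (hc1 : ∀ A ∈ rStabPart n r F, c A ∈ Finset.Icc 1 m)
    (hc2 : ∀ E : Finset (Finset ℕ), E.card = r → ↑E ⊆ rStabPart n r F →
      (∀ A ∈ E, ∀ B ∈ E, A ≠ B → Disjoint A B) → ∃ A ∈ E, ∃ B ∈ E, c A ≠ c B) :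
    (∀ A ∈ almostStabPart r F,
      (if rStable n r A then c A else m + 1) ∈ Finset.Icc 1 (m + 1)) ∧
    (∀ E : Finset (Finset ℕ), E.card = r → ↑E ⊆ almostStabPart r F →
      (∀ A ∈ E, ∀ B ∈ E, A ≠ B → Disjoint A B) →
        ∃ A ∈ E, ∃ B ∈ E,
          (if rStable n r A then c A else m + 1) ≠
          (if rStable n r B then c B else m + 1)) := by
  refine ⟨fun A hA => ?_, fun E hE hEF hd => ?_⟩
  · split_ifs with hs
    · exact Finset.Icc_subset_Icc_right m.le_succ (hc1 A ⟨hA.1, hs⟩)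
    · simp
  · by_cases hall : ∀ A ∈ E, rStable n r A
    · obtain ⟨A, hA, B, hB, hAB⟩ := hc2 E hE (fun A hA => ⟨(hEF hA).1, hall A hA⟩) hd
      exact ⟨A, hA, B, hB, by simpa [hall A hA, hall B hB] using hAB⟩
    · push Not at hall
      obtain ⟨B, hB, hBs⟩ := hall
      obtain ⟨A, hA, hAs⟩ := exists_rStable_of_card_eq r n hr E hE
        (fun A hA => hF A (hEF hA).1) (fun A hA => (hEF hA).2) hd
      have hcA := Finset.mem_Icc.1 (hc1 A ⟨(hEF hA).1, hAs⟩)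
      refine ⟨A, hA, B, hB, ?_⟩
      rw [if_pos hAs, if_neg hBs]
      omega

/-- For `r ≥ 2` and any set system `F` on `[n]`: given a proper `m`-coloring
`c` of `KG^r(F_{r-stab})`, the extension `c'` equal to `c` on `F_{r-stab}` and assigning the
new color `m + 1` to every member of `F_{~r-stab} ∖ F_{r-stab}` is a proper
`(m+1)`-coloring of `KG^r(F_{~r-stab})`; hence
`χ(KG^r(F_{~r-stab})) ≤ χ(KG^r(F_{r-stab})) + 1`. -/
theorem stmt_15 (r n : ℕ) (hr : 2 ≤ r)
    (F : Set (Finset ℕ)) (hF : ∀ A ∈ F, A ⊆ Finset.Icc 1 n)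
    (m : ℕ) (c : Finset ℕ → ℕ)
    (hc1 : ∀ A ∈ rStabPart n r F, c A ∈ Finset.Icc 1 m)
    (hc2 : ∀ E : Finset (Finset ℕ), E.card = r → ↑E ⊆ rStabPart n r F →
      (∀ A ∈ E, ∀ B ∈ E, A ≠ B → Disjoint A B) → ∃ A ∈ E, ∃ B ∈ E, c A ≠ c B) :
    (∀ A ∈ almostStabPart r F,
      (if rStable n r A then c A else m + 1) ∈ Finset.Icc 1 (m + 1)) ∧
    (∀ E : Finset (Finset ℕ), E.card = r → ↑E ⊆ almostStabPart r F →
      (∀ A ∈ E, ∀ B ∈ E, A ≠ B → Disjoint A B) →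
        ∃ A ∈ E, ∃ B ∈ E,
          (if rStable n r A then c A else m + 1) ≠
          (if rStable n r B then c B else m + 1)) ∧
    chiKG r (almostStabPart r F) ≤ chiKG r (rStabPart n r F) + 1 := by
  have hr' : 0 < r := by omega
  have hext := extension_proper r n hr' F hF m c hc1 hc2
  refine ⟨hext.1, hext.2, ?_⟩
  have hmin : KGColorable r (rStabPart n r F) (chiKG r (rStabPart n r F)) :=
    Nat.sInf_mem (s := {k | KGColorable r (rStabPart n r F) k}) ⟨m, c, hc1, hc2⟩
  obtain ⟨d, hd1, hd2⟩ := hmin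
  exact Nat.sInf_le ⟨_, extension_proper r n hr' F hF _ d hd1 hd2⟩
end
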